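/- arXiv:0903.3551 — 3 statements merged into one kernel-verified Lean document; each statement's English description precedes it below -/
import Mathlib

section
/- Let 0<q<1 and let z₁,z₂,z₃ be elements of a unital *-algebra A over ℂ satisfying the quantum 5-sphere relations. Then for every N ∈ ℕ: (i) ∑_{j+k+l=N} [j,k,l]! · (z₁ʲ z₂ᵏ z₃ˡ)(z₁ʲ z₂ᵏ z₃ˡ)* = 1, and (ii) ∑_{j+k+l=N} q^{2(j−l)} [j,k,l]! · (z₁ʲ z₂ᵏ z₃ˡ)*(z₁ʲ z₂ᵏ z₃ˡ) = q^{−2N}, where both sums run over triples (j,k,l) of natural numbers with j+k+l=N. -/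
open scoped BigOperators

/-- The `q`-number `[x] = (q^x - q^(-x))/(q - q⁻¹)`. -/
noncomputable def qNum (q x : ℝ) : ℝ := (q ^ x - q ^ (-x)) / (q - q⁻¹)

/-- The `q`-factorial `[n]! = [n][n-1]⋯[1]`, with `[0]! = 1`. -/
noncomputable def qFact (q : ℝ) (n : ℕ) : ℝ := ∏ i ∈ Finset.range n, qNum q (i + 1)

/-- The `q`-trinomial coefficient `[j,k,l]! = q^{-(jk+kl+lj)} [j+k+l]!/([j]![k]![l]!)`. -/
noncomputable def qTrinom (q : ℝ) (j k l : ℕ) : ℝ :=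
  q ^ (-((j * k + k * l + l * j : ℕ) : ℝ)) * qFact q (j + k + l) /
    (qFact q j * qFact q k * qFact q l)

/-- The triples `(j,k,l)` of natural numbers with `j+k+l = N`. -/
def triples (N : ℕ) : Finset (ℕ × ℕ × ℕ) :=
  (Finset.range (N + 1) ×ˢ Finset.range (N + 1) ×ˢ Finset.range (N + 1)).filter
    (fun p => p.1 + p.2.1 + p.2.2 = N)

theorem mem_triples {N : ℕ} {p : ℕ × ℕ × ℕ} : p ∈ triples N ↔ p.1 + p.2.1 + p.2.2 = N := by
  simp only [triples, Finset.mem_filter, Finset.mem_product, Finset.mem_range]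
  omega

section Triples

variable {M : Type*} [AddCommMonoid M]

theorem sum_triples_rev (N : ℕ) (f : ℕ × ℕ × ℕ → M) :
    ∑ p ∈ triples N, f p = ∑ p ∈ triples N, f (p.2.2, p.2.1, p.1) := by
  refine Finset.sum_nbij' (fun p => (p.2.2, p.2.1, p.1)) (fun p => (p.2.2, p.2.1, p.1))
    ?_ ?_ ?_ ?_ ?_ <;> simp only [mem_triples, implies_true] <;> intros <;> omega

theorem sum_triples_cycle (N : ℕ) (f : ℕ × ℕ × ℕ → M) :
    ∑ p ∈ triples N, f p = ∑ p ∈ triples N, f (p.2.1, p.2.2, p.1) := by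
  refine Finset.sum_nbij' (fun p => (p.2.2, p.1, p.2.1)) (fun p => (p.2.1, p.2.2, p.1))
    ?_ ?_ ?_ ?_ ?_ <;> simp only [mem_triples, implies_true] <;> intros <;> omega

theorem sum_triples_succ_fst (N : ℕ) (f : ℕ × ℕ × ℕ → M) (hf : ∀ k l, f (0, k, l) = 0) :
    ∑ p ∈ triples (N + 1), f p = ∑ p ∈ triples N, f (p.1 + 1, p.2.1, p.2.2) := by
  symm
  refine Finset.sum_of_injOn (fun p => (p.1 + 1, p.2.1, p.2.2)) ?_ ?_ ?_ (fun _ _ => rfl)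
  · rintro ⟨a, b, c⟩ _ ⟨a', b', c'⟩ _ h
    simpa using h
  · rintro ⟨a, b, c⟩ h
    simp only [Finset.mem_coe, mem_triples] at h ⊢
    omega
  · rintro ⟨a, b, c⟩ h h'
    rcases a with _ | a
    · exact hf b c
    · refine absurd ⟨(a, b, c), ?_, rfl⟩ h'
      simp only [Finset.mem_coe, mem_triples] at h ⊢
      omega

theorem sum_triples_succ_snd (N : ℕ) (f : ℕ × ℕ × ℕ → M) (hf : ∀ j l, f (j, 0, l) = 0) :
    ∑ p ∈ triples (N + 1), f p = ∑ p ∈ triples N, f (p.1, p.2.1 + 1, p.2.2) := by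
  rw [← sum_triples_cycle N fun p => f (p.2.2, p.1 + 1, p.2.1),
    ← sum_triples_succ_fst N (fun p => f (p.2.2, p.1, p.2.1)) fun k l => hf l k,
    sum_triples_cycle (N + 1) fun p => f (p.2.2, p.1, p.2.1)]

theorem sum_triples_succ_trd (N : ℕ) (f : ℕ × ℕ × ℕ → M) (hf : ∀ j k, f (j, k, 0) = 0) :
    ∑ p ∈ triples (N + 1), f p = ∑ p ∈ triples N, f (p.1, p.2.1, p.2.2 + 1) := by
  rw [sum_triples_rev, sum_triples_succ_fst N _ fun k l => hf l k,
    sum_triples_rev N fun p => f (p.1, p.2.1, p.2.2 + 1)]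

end Triples

section QNumbers

variable {q : ℝ}

theorem qNum_zero : qNum q 0 = 0 := by simp [qNum]

theorem qNum_add (hq : 0 < q) (x y : ℝ) :
    qNum q (x + y) = q ^ (-y) * qNum q x + q ^ x * qNum q y := by
  simp only [qNum, neg_add, Real.rpow_add hq]
  ring

theorem qNum_pos (hq : 0 < q) (hq1 : q < 1) {x : ℝ} (hx : 0 < x) : 0 < qNum q x := by
  refine div_pos_of_neg_of_neg ?_ ?_
  · have := Real.rpow_lt_rpow_of_exponent_gt hq hq1 (show -x < x by linarith)
    linarith
  · have := one_lt_inv_iff₀.mpr ⟨hq, hq1⟩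
    linarith

theorem qFact_pos (hq : 0 < q) (hq1 : q < 1) (n : ℕ) : 0 < qFact q n :=
  Finset.prod_pos fun _ _ => qNum_pos hq hq1 (by positivity)

theorem qFact_succ (n : ℕ) : qFact q (n + 1) = qFact q n * qNum q (n + 1) :=
  Finset.prod_range_succ _ _

theorem qTrinom_rev (j k l : ℕ) : qTrinom q j k l = qTrinom q l k j := by
  simp only [qTrinom]
  rw [show j * k + k * l + l * j = l * k + k * j + j * l by ring,
    show j + k + l = l + k + j by ring]
  ring

theorem qTrinom_cycle (j k l : ℕ) : qTrinom q j k l = qTrinom q k l j := by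
  simp only [qTrinom]
  rw [show j * k + k * l + l * j = k * l + l * j + j * k by ring,
    show j + k + l = k + l + j by ring]
  ring

theorem qTrinom_succ_fst (hq : 0 < q) (hq1 : q < 1) (j k l : ℕ) :
    qNum q (j + 1) * qTrinom q (j + 1) k l =
      (q ^ (k + l))⁻¹ * qNum q (j + k + l + 1) * qTrinom q j k l := by
  have hj := qNum_pos hq hq1 (show (0 : ℝ) < j + 1 by positivity)
  have := (qFact_pos hq hq1 j).ne'
  have := (qFact_pos hq hq1 k).ne'
  have := (qFact_pos hq hq1 l).ne'
  rw [qTrinom, qTrinom, show j + 1 + k + l = j + k + l + 1 by ring, qFact_succ, qFact_succ,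
    show (j + 1) * k + k * l + l * (j + 1) = (j * k + k * l + l * j) + (k + l) by ring,
    Nat.cast_add, neg_add, Real.rpow_add hq, Real.rpow_neg hq.le (((k + l : ℕ)) : ℝ),
    Real.rpow_natCast]
  push_cast
  field_simp

/-- The `q`-Pascal rule, summed against an arbitrary family. -/
theorem sum_qTrinom_succ (hq : 0 < q) (hq1 : q < 1) {M : Type*} [AddCommGroup M] [Module ℝ M]
    (N : ℕ) (f : ℕ → ℕ → ℕ → M) :
    ∑ p ∈ triples (N + 1), qTrinom q p.1 p.2.1 p.2.2 • f p.1 p.2.1 p.2.2 =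
      ∑ p ∈ triples N, qTrinom q p.1 p.2.1 p.2.2 •
        (((q ^ (p.2.1 + p.2.2)) ^ 2)⁻¹ • f (p.1 + 1) p.2.1 p.2.2 +
          ((q ^ p.2.2) ^ 2)⁻¹ • f p.1 (p.2.1 + 1) p.2.2 + f p.1 p.2.1 (p.2.2 + 1)) := by
  have hN : qNum q (N + 1) ≠ 0 := (qNum_pos hq hq1 (by positivity)).ne'
  have hsplit : ∀ p ∈ triples (N + 1),
      qTrinom q p.1 p.2.1 p.2.2 • f p.1 p.2.1 p.2.2 =
        ((qNum q (N + 1))⁻¹ * (q ^ (p.2.1 + p.2.2))⁻¹ *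
            (qNum q p.1 * qTrinom q p.1 p.2.1 p.2.2)) • f p.1 p.2.1 p.2.2 +
          ((qNum q (N + 1))⁻¹ * (q ^ p.1 * (q ^ p.2.2)⁻¹) *
            (qNum q p.2.1 * qTrinom q p.1 p.2.1 p.2.2)) • f p.1 p.2.1 p.2.2 +
          ((qNum q (N + 1))⁻¹ * q ^ (p.1 + p.2.1) *
            (qNum q p.2.2 * qTrinom q p.1 p.2.1 p.2.2)) • f p.1 p.2.1 p.2.2 := by
    rintro ⟨j, k, l⟩ hp
    rw [mem_triples] at hp
    have hsum : qNum q (N + 1) =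
        (q ^ (k + l))⁻¹ * qNum q j + q ^ j * (q ^ l)⁻¹ * qNum q k + q ^ (j + k) * qNum q l := by
      rw [show (N + 1 : ℝ) = j + k + l by exact_mod_cast hp.symm, qNum_add hq, qNum_add hq,
        Real.rpow_neg hq.le, Real.rpow_neg hq.le, Real.rpow_add hq]
      simp only [Real.rpow_natCast, pow_add]
      field_simp
    rw [← add_smul, ← add_smul]
    congr 1
    field_simp
    rw [hsum]
    field_simp
  rw [Finset.sum_congr rfl hsplit, Finset.sum_add_distrib, Finset.sum_add_distrib,
    sum_triples_succ_fst N _ fun k l => by simp [qNum_zero],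
    sum_triples_succ_snd N _ fun j l => by simp [qNum_zero],
    sum_triples_succ_trd N _ fun j k => by simp [qNum_zero],
    ← Finset.sum_add_distrib, ← Finset.sum_add_distrib]
  refine Finset.sum_congr rfl ?_
  rintro ⟨j, k, l⟩ hp
  rw [mem_triples] at hp
  have hp' : (N : ℝ) = j + k + l := by exact_mod_cast hp.symm
  rw [hp'] at hN ⊢
  have h₁ := qTrinom_succ_fst hq hq1 j k l
  have h₂ := qTrinom_succ_fst hq hq1 k l j
  have h₃ := qTrinom_succ_fst hq hq1 l j k
  rw [← qTrinom_cycle j (k + 1) l, ← qTrinom_cycle j k l, show (k + l + j : ℝ) = j + k + l by ring] at h₂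
  rw [qTrinom_cycle (l + 1) j k, qTrinom_cycle l j k, show (l + j + k : ℝ) = j + k + l by ring] at h₃
  simp only [smul_add, smul_smul]
  push_cast
  congr 2
  · congr 1
    rw [h₁]
    field_simp
  · congr 1
    rw [h₂, pow_add]
    field_simp
  · rw [h₃]
    field_simp

theorem sum_qTrinom_succ' (hq : 0 < q) (hq1 : q < 1) {M : Type*} [AddCommGroup M] [Module ℝ M]
    (N : ℕ) (f : ℕ → ℕ → ℕ → M) :
    ∑ p ∈ triples (N + 1), qTrinom q p.1 p.2.1 p.2.2 • f p.1 p.2.1 p.2.2 =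
      ∑ p ∈ triples N, qTrinom q p.1 p.2.1 p.2.2 •
        (f (p.1 + 1) p.2.1 p.2.2 + ((q ^ p.1) ^ 2)⁻¹ • f p.1 (p.2.1 + 1) p.2.2 +
          ((q ^ (p.1 + p.2.1)) ^ 2)⁻¹ • f p.1 p.2.1 (p.2.2 + 1)) := by
  rw [sum_triples_rev, sum_triples_rev N]
  simp only [qTrinom_rev]
  rw [sum_qTrinom_succ hq hq1 N fun j k l => f l k j]
  refine Finset.sum_congr rfl fun p _ => ?_
  rw [add_comm p.2.2 p.2.1]
  congr 1
  abel

theorem qTrinom_zero : qTrinom q 0 0 0 = 1 := by simp [qTrinom, qFact]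

end QNumbers

section QCommute

variable {A : Type*} [Ring A] [Algebra ℝ A] {q : ℝ} {x y : A}

theorem mul_pow_of_qCommute (h : x * y = q • (y * x)) (n : ℕ) :
    x * y ^ n = q ^ n • (y ^ n * x) := by
  induction n with
  | zero => simp
  | succ n ih =>
    rw [pow_succ, ← mul_assoc, ih, smul_mul_assoc, mul_assoc, h, mul_smul_comm, smul_smul,
      mul_assoc, pow_succ]

theorem pow_mul_of_qCommute (h : x * y = q • (y * x)) (n : ℕ) :
    x ^ n * y = q ^ n • (y * x ^ n) := by
  induction n with
  | zero => simp
  | succ n ih =>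
    rw [pow_succ', mul_assoc, ih, mul_smul_comm, ← mul_assoc, h, smul_mul_assoc, smul_smul,
      mul_assoc, pow_succ]

end QCommute

section Sphere

variable {A : Type*} [Ring A] [StarRing A] [Algebra ℝ A] {q : ℝ} {z₁ z₂ z₃ : A}

/-- The sphere relation with the factors in the opposite order. -/
theorem weighted_star_mul_sum (hq : 0 < q)
    (h1 : star z₁ * z₁ = z₁ * star z₁)
    (h2 : star z₂ * z₂ - z₂ * star z₂ = (1 - q ^ 2) • (z₁ * star z₁))
    (h3 : star z₃ * z₃ - z₃ * star z₃ = (1 - q ^ 2) • (z₁ * star z₁ + z₂ * star z₂))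
    (hsphere : z₁ * star z₁ + z₂ * star z₂ + z₃ * star z₃ = 1) :
    q ^ 2 • (star z₁ * z₁) + star z₂ * z₂ + (q ^ 2)⁻¹ • (star z₃ * z₃) =
      (q ^ 2)⁻¹ • (1 : A) := by
  rw [h1, sub_eq_iff_eq_add.mp h2, sub_eq_iff_eq_add.mp h3, ← hsphere]
  match_scalars <;> field_simp <;> ring

variable [StarModule ℝ A]

theorem smul_mul_star_smul (c : ℝ) (x : A) :
    (c • x) * star (c • x) = c ^ 2 • (x * star x) := by
  rw [star_smul, star_trivial, smul_mul_smul_comm, pow_two]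

theorem star_smul_mul_smul (c : ℝ) (x : A) :
    star (c • x) * (c • x) = c ^ 2 • (star x * x) := by
  rw [star_smul, star_trivial, smul_mul_smul_comm, pow_two]

theorem sum_qTrinom_mul_star (hq : 0 < q) (hq1 : q < 1)
    (h12 : z₁ * z₂ = q • (z₂ * z₁)) (h13 : z₁ * z₃ = q • (z₃ * z₁))
    (h23 : z₂ * z₃ = q • (z₃ * z₂))
    (hsphere : z₁ * star z₁ + z₂ * star z₂ + z₃ * star z₃ = 1) (N : ℕ) :
    ∑ p ∈ triples N, qTrinom q p.1 p.2.1 p.2.2 •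
      ((z₁ ^ p.1 * z₂ ^ p.2.1 * z₃ ^ p.2.2) *
        star (z₁ ^ p.1 * z₂ ^ p.2.1 * z₃ ^ p.2.2)) = 1 := by
  induction N with
  | zero => simp [show triples 0 = {(0, 0, 0)} from rfl, qTrinom_zero]
  | succ N ih =>
    rw [sum_qTrinom_succ hq hq1 N fun j k l =>
      (z₁ ^ j * z₂ ^ k * z₃ ^ l) * star (z₁ ^ j * z₂ ^ k * z₃ ^ l), ← ih]
    refine Finset.sum_congr rfl ?_
    rintro ⟨j, k, l⟩ -
    have e₁ : z₁ ^ (j + 1) * z₂ ^ k * z₃ ^ l =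
        q ^ (k + l) • (z₁ ^ j * z₂ ^ k * z₃ ^ l * z₁) := by
      rw [pow_succ, mul_assoc (z₁ ^ j), mul_pow_of_qCommute h12, mul_smul_comm, smul_mul_assoc,
        mul_assoc, mul_assoc (z₂ ^ k), mul_pow_of_qCommute h13, mul_smul_comm, mul_smul_comm,
        smul_smul, pow_add]
      simp only [mul_assoc]
    have e₂ : z₁ ^ j * z₂ ^ (k + 1) * z₃ ^ l =
        q ^ l • (z₁ ^ j * z₂ ^ k * z₃ ^ l * z₂) := by
      rw [pow_succ, mul_assoc, mul_assoc (z₂ ^ k), mul_pow_of_qCommute h23, mul_smul_comm,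
        mul_smul_comm]
      simp only [mul_assoc]
    have e₃ : z₁ ^ j * z₂ ^ k * z₃ ^ (l + 1) = z₁ ^ j * z₂ ^ k * z₃ ^ l * z₃ := by
      simp only [pow_succ, mul_assoc]
    dsimp only
    rw [e₁, e₂, e₃, smul_mul_star_smul, smul_mul_star_smul,
      inv_smul_smul₀ (by positivity), inv_smul_smul₀ (by positivity)]
    generalize z₁ ^ j * z₂ ^ k * z₃ ^ l = w
    congr 1
    calc _ = w * (z₁ * star z₁ + z₂ * star z₂ + z₃ * star z₃) * star w := by
          simp only [star_mul]
          noncomm_ring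
      _ = w * star w := by rw [hsphere, mul_one]

theorem sum_qTrinom_star_mul (hq : 0 < q) (hq1 : q < 1)
    (h12 : z₁ * z₂ = q • (z₂ * z₁)) (h13 : z₁ * z₃ = q • (z₃ * z₁))
    (h23 : z₂ * z₃ = q • (z₃ * z₂))
    (hsphere : q ^ 2 • (star z₁ * z₁) + star z₂ * z₂ + (q ^ 2)⁻¹ • (star z₃ * z₃) =
      (q ^ 2)⁻¹ • (1 : A)) (N : ℕ) :
    ∑ p ∈ triples N, qTrinom q p.1 p.2.1 p.2.2 • q ^ (2 * ((p.1 : ℝ) - p.2.2)) •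
      (star (z₁ ^ p.1 * z₂ ^ p.2.1 * z₃ ^ p.2.2) *
        (z₁ ^ p.1 * z₂ ^ p.2.1 * z₃ ^ p.2.2)) = ((q ^ 2)⁻¹) ^ N • (1 : A) := by
  induction N with
  | zero => simp [show triples 0 = {(0, 0, 0)} from rfl, qTrinom_zero]
  | succ N ih =>
    rw [sum_qTrinom_succ' hq hq1 N fun j k l => q ^ (2 * ((j : ℝ) - l)) •
      (star (z₁ ^ j * z₂ ^ k * z₃ ^ l) * (z₁ ^ j * z₂ ^ k * z₃ ^ l)), pow_succ', mul_smul,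
      ← ih, Finset.smul_sum]
    refine Finset.sum_congr rfl ?_
    rintro ⟨j, k, l⟩ -
    have e₁ : z₁ ^ (j + 1) * z₂ ^ k * z₃ ^ l = z₁ * (z₁ ^ j * z₂ ^ k * z₃ ^ l) := by
      simp only [pow_succ', mul_assoc]
    have e₂ : z₁ ^ j * z₂ ^ (k + 1) * z₃ ^ l =
        q ^ j • (z₂ * (z₁ ^ j * z₂ ^ k * z₃ ^ l)) := by
      rw [pow_succ', ← mul_assoc, pow_mul_of_qCommute h12, smul_mul_assoc, smul_mul_assoc]
      simp only [mul_assoc]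
    have e₃ : z₁ ^ j * z₂ ^ k * z₃ ^ (l + 1) =
        q ^ (j + k) • (z₃ * (z₁ ^ j * z₂ ^ k * z₃ ^ l)) := by
      rw [pow_succ', ← mul_assoc, mul_assoc (z₁ ^ j), pow_mul_of_qCommute h23, mul_smul_comm,
        ← mul_assoc, pow_mul_of_qCommute h13, smul_mul_assoc, smul_mul_assoc,
        smul_mul_assoc, smul_smul, mul_comm (q ^ k), pow_add]
      simp only [mul_assoc]
    have r₁ : q ^ (2 * (((j + 1 : ℕ) : ℝ) - l)) = q ^ (2 * ((j : ℝ) - l)) * q ^ 2 := by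
      rw [← Real.rpow_natCast q 2, ← Real.rpow_add hq]
      push_cast
      ring_nf
    have r₃ : q ^ (2 * ((j : ℝ) - ((l + 1 : ℕ) : ℝ))) = q ^ (2 * ((j : ℝ) - l)) * (q ^ 2)⁻¹ := by
      rw [← Real.rpow_natCast q 2, ← Real.rpow_neg hq.le, ← Real.rpow_add hq]
      push_cast
      ring_nf
    dsimp only
    rw [e₁, e₂, e₃, r₁, r₃, star_smul_mul_smul, star_smul_mul_smul, smul_comm ((q ^ j) ^ 2)⁻¹,
      smul_comm ((q ^ (j + k)) ^ 2)⁻¹, inv_smul_smul₀ (by positivity),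
      inv_smul_smul₀ (by positivity), smul_comm (q ^ 2)⁻¹, smul_comm (q ^ 2)⁻¹]
    generalize z₁ ^ j * z₂ ^ k * z₃ ^ l = w
    rw [mul_smul, mul_smul, ← smul_add, ← smul_add]
    congr 2
    calc _ = star w * (q ^ 2 • (star z₁ * z₁) + star z₂ * z₂ +
            (q ^ 2)⁻¹ • (star z₃ * z₃)) * w := by
          simp only [star_mul, mul_add, add_mul, mul_smul_comm, smul_mul_assoc, mul_assoc]
      _ = (q ^ 2)⁻¹ • (star w * w) := by
          rw [hsphere, mul_smul_comm, mul_one, smul_mul_assoc]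

end Sphere

theorem statement0
    (q : ℝ) (hq : 0 < q) (hq1 : q < 1)
    (A : Type*) [Ring A] [StarRing A] [Algebra ℂ A] [StarModule ℂ A]
    (z₁ z₂ z₃ : A)
    -- quantum 5-sphere relations
    (h12 : z₁ * z₂ = (q : ℂ) • (z₂ * z₁))
    (h13 : z₁ * z₃ = (q : ℂ) • (z₃ * z₁))
    (h23 : z₂ * z₃ = (q : ℂ) • (z₃ * z₂))
    (hs12 : star z₁ * z₂ = (q : ℂ) • (z₂ * star z₁))
    (hs13 : star z₁ * z₃ = (q : ℂ) • (z₃ * star z₁))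
    (hs21 : star z₂ * z₁ = (q : ℂ) • (z₁ * star z₂))
    (hs23 : star z₂ * z₃ = (q : ℂ) • (z₃ * star z₂))
    (hs31 : star z₃ * z₁ = (q : ℂ) • (z₁ * star z₃))
    (hs32 : star z₃ * z₂ = (q : ℂ) • (z₂ * star z₃))
    (h1 : star z₁ * z₁ = z₁ * star z₁)
    (h2 : star z₂ * z₂ - z₂ * star z₂ = ((1 - q ^ 2 : ℝ) : ℂ) • (z₁ * star z₁))
    (h3 : star z₃ * z₃ - z₃ * star z₃ =
      ((1 - q ^ 2 : ℝ) : ℂ) • (z₁ * star z₁ + z₂ * star z₂))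
    (hsphere : z₁ * star z₁ + z₂ * star z₂ + z₃ * star z₃ = 1)
    (N : ℕ) :
    (∑ p ∈ triples N,
        ((qTrinom q p.1 p.2.1 p.2.2 : ℝ) : ℂ) •
          ((z₁ ^ p.1 * z₂ ^ p.2.1 * z₃ ^ p.2.2) *
            star (z₁ ^ p.1 * z₂ ^ p.2.1 * z₃ ^ p.2.2)) = 1) ∧
    (∑ p ∈ triples N,
        ((q ^ (2 * ((p.1 : ℝ) - (p.2.2 : ℝ))) * qTrinom q p.1 p.2.1 p.2.2 : ℝ) : ℂ) •
          (star (z₁ ^ p.1 * z₂ ^ p.2.1 * z₃ ^ p.2.2) *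
            (z₁ ^ p.1 * z₂ ^ p.2.1 * z₃ ^ p.2.2)) =
      ((q ^ (-(2 * (N : ℝ))) : ℝ) : ℂ) • (1 : A)) := by
  simp only [Complex.coe_smul] at *
  refine ⟨sum_qTrinom_mul_star hq hq1 h12 h13 h23 hsphere N, ?_⟩
  have h := sum_qTrinom_star_mul hq hq1 h12 h13 h23
    (weighted_star_mul_sum hq h1 h2 h3 hsphere) N
  simp only [smul_smul, mul_comm (qTrinom q _ _ _)] at h
  rw [h, Real.rpow_neg hq.le, inv_pow, ← pow_mul, ← Real.rpow_natCast]
  push_cast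
  rfl
end

section
/- Let 0<q<1. For all natural numbers n and N the following two identities of q-numbers (with real arguments) hold: (i) ((q^{3/2}+q^{−3/2})/(q^{N/3}+q^{−N/3})) · ([n+N/3+1]² + [n+2N/3+1]² − [N/3+1]² − [2N/3+1]²) = q^{3/2}(1+q^{−3})·[n]·[n+N+2]; (ii) ((q^{3/2}+q^{−3/2})/(q^{N/3}+q^{−N/3})) · ([n+N/3+1]² + [n+2N/3+1]² − [N/3−1]² − [2N/3−1]²) = q^{3/2}(1+q^{−3})·[n+2]·[n+N]. (These give the eigenvalues λ_{n,±N} = (1+q^{−3})[n][n+N+2] + [2][N], respectively (1+q^{−3})[n+2][n+N] + [2][−N], of the gauged Laplacian on the monopole bundle of charge ±N over the quantum projective plane.) -/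
theorem qNum_sq_sub_qNum_sq {q : ℝ} (hq : 0 < q) (a b : ℝ) :
    qNum q a ^ 2 - qNum q b ^ 2 = qNum q (a + b) * qNum q (a - b) := by
  have ha : q ^ a ≠ 0 := (Real.rpow_pos_of_pos hq a).ne'
  have hb : q ^ b ≠ 0 := (Real.rpow_pos_of_pos hq b).ne'
  simp only [qNum, div_pow, ← sub_div, div_mul_div_comm, ← sq]
  congr 1
  simp only [Real.rpow_neg hq.le, Real.rpow_add hq, Real.rpow_sub hq]
  field_simp
  ring

theorem qNum_add_add_qNum_sub {q : ℝ} (hq : 0 < q) (x y : ℝ) :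
    qNum q (x + y) + qNum q (x - y) = qNum q x * (q ^ y + q ^ (-y)) := by
  have hx : q ^ x ≠ 0 := (Real.rpow_pos_of_pos hq x).ne'
  have hy : q ^ y ≠ 0 := (Real.rpow_pos_of_pos hq y).ne'
  simp only [qNum, ← add_div, div_mul_eq_mul_div]
  congr 1
  simp only [Real.rpow_neg hq.le, Real.rpow_add hq, Real.rpow_sub hq]
  field_simp
  ring

theorem statement8
    (q : ℝ) (hq : 0 < q) (hq1 : q < 1) :
    ∀ n N : ℕ,
      ((q ^ ((3 : ℝ) / 2) + q ^ (-(3 : ℝ) / 2)) / (q ^ ((N : ℝ) / 3) + q ^ (-((N : ℝ) / 3)))) *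
          (qNum q ((n : ℝ) + (N : ℝ) / 3 + 1) ^ 2 + qNum q ((n : ℝ) + 2 * (N : ℝ) / 3 + 1) ^ 2 -
            qNum q ((N : ℝ) / 3 + 1) ^ 2 - qNum q (2 * (N : ℝ) / 3 + 1) ^ 2) =
        q ^ ((3 : ℝ) / 2) * (1 + q ^ (-(3 : ℝ))) * qNum q (n : ℝ) *
          qNum q ((n : ℝ) + (N : ℝ) + 2) ∧
      ((q ^ ((3 : ℝ) / 2) + q ^ (-(3 : ℝ) / 2)) / (q ^ ((N : ℝ) / 3) + q ^ (-((N : ℝ) / 3)))) *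
          (qNum q ((n : ℝ) + (N : ℝ) / 3 + 1) ^ 2 + qNum q ((n : ℝ) + 2 * (N : ℝ) / 3 + 1) ^ 2 -
            qNum q ((N : ℝ) / 3 - 1) ^ 2 - qNum q (2 * (N : ℝ) / 3 - 1) ^ 2) =
        q ^ ((3 : ℝ) / 2) * (1 + q ^ (-(3 : ℝ))) * qNum q ((n : ℝ) + 2) *
          qNum q ((n : ℝ) + (N : ℝ)) := by
  intro n N
  have hK : q ^ ((3 : ℝ) / 2) * (1 + q ^ (-(3 : ℝ))) =
      q ^ ((3 : ℝ) / 2) + q ^ (-(3 : ℝ) / 2) := by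
    rw [mul_add, mul_one, ← Real.rpow_add hq]
    norm_num
  have hD : q ^ ((N : ℝ) / 3) + q ^ (-((N : ℝ) / 3)) ≠ 0 :=
    (add_pos (Real.rpow_pos_of_pos hq _) (Real.rpow_pos_of_pos hq _)).ne'
  rw [hK]
  constructor
  · have h₁ := qNum_sq_sub_qNum_sq hq ((n : ℝ) + (N : ℝ) / 3 + 1) ((N : ℝ) / 3 + 1)
    have h₂ := qNum_sq_sub_qNum_sq hq ((n : ℝ) + 2 * (N : ℝ) / 3 + 1) (2 * (N : ℝ) / 3 + 1)
    have h₃ := qNum_add_add_qNum_sub hq ((n : ℝ) + (N : ℝ) + 2) ((N : ℝ) / 3)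
    rw [show (n : ℝ) + N / 3 + 1 + (N / 3 + 1) = n + N + 2 - N / 3 by ring,
      show (n : ℝ) + N / 3 + 1 - (N / 3 + 1) = n by ring] at h₁
    rw [show (n : ℝ) + 2 * N / 3 + 1 + (2 * N / 3 + 1) = n + N + 2 + N / 3 by ring,
      show (n : ℝ) + 2 * N / 3 + 1 - (2 * N / 3 + 1) = n by ring] at h₂
    rw [div_mul_eq_mul_div, div_eq_iff hD]
    linear_combination (q ^ ((3 : ℝ) / 2) + q ^ (-(3 : ℝ) / 2)) * (h₁ + h₂ + qNum q n * h₃)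
  · have h₁ := qNum_sq_sub_qNum_sq hq ((n : ℝ) + (N : ℝ) / 3 + 1) (2 * (N : ℝ) / 3 - 1)
    have h₂ := qNum_sq_sub_qNum_sq hq ((n : ℝ) + 2 * (N : ℝ) / 3 + 1) ((N : ℝ) / 3 - 1)
    have h₃ := qNum_add_add_qNum_sub hq ((n : ℝ) + 2) ((N : ℝ) / 3)
    rw [show (n : ℝ) + N / 3 + 1 + (2 * N / 3 - 1) = n + N by ring,
      show (n : ℝ) + N / 3 + 1 - (2 * N / 3 - 1) = n + 2 - N / 3 by ring] at h₁
    rw [show (n : ℝ) + 2 * N / 3 + 1 + (N / 3 - 1) = n + N by ring,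
      show (n : ℝ) + 2 * N / 3 + 1 - (N / 3 - 1) = n + 2 + N / 3 by ring] at h₂
    rw [div_mul_eq_mul_div, div_eq_iff hD]
    linear_combination (q ^ ((3 : ℝ) / 2) + q ^ (-(3 : ℝ) / 2)) *
      (h₁ + h₂ + qNum q (n + N) * h₃)
end

section
/- Let 0<q<1 and define the bilinear maps μ₀,…,μ₄ as in the context. Then for all v, v′, v″ ∈ ℂ² and w ∈ ℂ³ the following five identities hold: (i) μ₄(μ₁(v,v′), w) = μ₀(v, μ₂(v′,w)); (ii) μ₀(μ₂(v,w), v′) = μ₀(v, μ₃(w,v′)); (iii) μ₀(μ₃(w,v), v′) = μ₄(w, μ₁(v,v′)); (iv) μ₂(v, μ₁(v′,v″)) = [2]·μ₀(v,v′)·v″ + μ₀(v′,v″)·v; (v) μ₃(μ₁(v,v′), v″) = μ₀(v,v′)·v″ + [2]·μ₀(v′,v″)·v. -/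
noncomputable section

/-- `q^{1/2}` as a complex number. -/
def sqQ (q : ℝ) : ℂ := (Real.sqrt q : ℂ)

/-- `[2]^{1/2} = (q + q⁻¹)^{1/2}` as a complex number. -/
def sqTwo (q : ℝ) : ℂ := (Real.sqrt (q + q⁻¹) : ℂ)

/-- `μ₀(v,w) = [2]^{-1/2}(q^{1/2} v₁w₂ - q^{-1/2} v₂w₁)`. -/
def mu0 (q : ℝ) (v w : Fin 2 → ℂ) : ℂ :=
  (sqTwo q)⁻¹ * (sqQ q * (v 0 * w 1) - (sqQ q)⁻¹ * (v 1 * w 0))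

/-- `μ₁(v,w) = (v₁w₁, [2]^{-1/2}(q^{-1/2} v₁w₂ + q^{1/2} v₂w₁), v₂w₂)`. -/
def mu1 (q : ℝ) (v w : Fin 2 → ℂ) : Fin 3 → ℂ :=
  ![v 0 * w 0, (sqTwo q)⁻¹ * ((sqQ q)⁻¹ * (v 0 * w 1) + sqQ q * (v 1 * w 0)), v 1 * w 1]

/-- `μ₂(v,w) = (q v₁w₂ - q^{-1/2}[2]^{1/2} v₂w₁, q^{1/2}[2]^{1/2} v₁w₃ - q^{-1} v₂w₂)`. -/
def mu2 (q : ℝ) (v : Fin 2 → ℂ) (w : Fin 3 → ℂ) : Fin 2 → ℂ :=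
  ![(q : ℂ) * (v 0 * w 1) - (sqQ q)⁻¹ * sqTwo q * (v 1 * w 0),
    sqQ q * sqTwo q * (v 0 * w 2) - (q : ℂ)⁻¹ * (v 1 * w 1)]

/-- `μ₃(v,w) = (q^{1/2}[2]^{1/2} v₁w₂ - q^{-1} v₂w₁, q v₂w₂ - q^{-1/2}[2]^{1/2} v₃w₁)`. -/
def mu3 (q : ℝ) (v : Fin 3 → ℂ) (w : Fin 2 → ℂ) : Fin 2 → ℂ :=
  ![sqQ q * sqTwo q * (v 0 * w 1) - (q : ℂ)⁻¹ * (v 1 * w 0),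
    (q : ℂ) * (v 1 * w 1) - (sqQ q)⁻¹ * sqTwo q * (v 2 * w 0)]

/-- `μ₄(v,w) = q v₁w₃ - v₂w₂ + q⁻¹ v₃w₁`. -/
def mu4 (q : ℝ) (v w : Fin 3 → ℂ) : ℂ :=
  (q : ℂ) * (v 0 * w 2) - v 1 * w 1 + (q : ℂ)⁻¹ * (v 2 * w 0)

end

theorem sqQ_sq {q : ℝ} (hq : 0 ≤ q) : sqQ q ^ 2 = (q : ℂ) := by
  rw [sqQ, ← Complex.ofReal_pow, Real.sq_sqrt hq]

theorem sqQ_ne_zero {q : ℝ} (hq : 0 < q) : sqQ q ≠ 0 :=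
  Complex.ofReal_ne_zero.mpr (Real.sqrt_pos.mpr hq).ne'

theorem sqTwo_sq {q : ℝ} (hq : 0 ≤ q) : sqTwo q ^ 2 = ((q + q⁻¹ : ℝ) : ℂ) := by
  rw [sqTwo, ← Complex.ofReal_pow, Real.sq_sqrt (by positivity)]

theorem sqTwo_ne_zero {q : ℝ} (hq : 0 < q) : sqTwo q ≠ 0 :=
  Complex.ofReal_ne_zero.mpr (Real.sqrt_pos.mpr (by positivity)).ne'

theorem statement10
    (q : ℝ) (hq : 0 < q) (hq1 : q < 1) :
    ∀ (v v' v'' : Fin 2 → ℂ) (w : Fin 3 → ℂ),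
      mu4 q (mu1 q v v') w = mu0 q v (mu2 q v' w) ∧
      mu0 q (mu2 q v w) v' = mu0 q v (mu3 q w v') ∧
      mu0 q (mu3 q w v) v' = mu4 q w (mu1 q v v') ∧
      mu2 q v (mu1 q v' v'') =
        (((q + q⁻¹ : ℝ) : ℂ) * mu0 q v v') • v'' + mu0 q v' v'' • v ∧
      mu3 q (mu1 q v v') v'' =
        mu0 q v v' • v'' + (((q + q⁻¹ : ℝ) : ℂ) * mu0 q v' v'') • v := by
  intro v v' v'' w
  have hs : sqQ q ≠ 0 := sqQ_ne_zero hq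
  have ht : sqTwo q ≠ 0 := sqTwo_ne_zero hq
  have hqs : (q : ℂ) = sqQ q ^ 2 := (sqQ_sq hq.le).symm
  have htwo : ((q + q⁻¹ : ℝ) : ℂ) = sqTwo q ^ 2 := (sqTwo_sq hq.le).symm
  have hst : sqQ q ^ 2 * sqTwo q ^ 2 = sqQ q ^ 4 + 1 := by
    rw [← htwo]
    push_cast
    rw [hqs]
    field_simp
  refine ⟨?_, ?_, ?_, ?_, ?_⟩
  · simp only [mu0, mu1, mu2, mu4, hqs, Matrix.cons_val]
    field_simp
    ring
  · simp only [mu0, mu2, mu3, hqs, Matrix.cons_val]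
    field_simp
    ring
  · simp only [mu0, mu1, mu3, mu4, hqs, Matrix.cons_val]
    field_simp
    ring
  · rw [htwo]
    ext i
    fin_cases i
    · simp [mu0, mu1, mu2, hqs]
      field_simp
      linear_combination (-(v 0 * v' 1 * v'' 0)) * hst
    · simp [mu0, mu1, mu2, hqs]
      field_simp
      linear_combination (v 1 * v' 0 * v'' 1) * hst
  · rw [htwo]
    ext i
    fin_cases i
    · simp [mu0, mu1, mu3, hqs]
      field_simp
      linear_combination (v 0 * v' 1 * v'' 0) * hst
    · simp [mu0, mu1, mu3, hqs]
      field_simp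
      linear_combination (-(v 1 * v' 0 * v'' 1)) * hst
end
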